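/- Consider a Bianchi IX solution of the Wainwright–Hsu system on (-∞, 0]. If the solution has an α-limit point, then N₁N₂N₃ → 0 as τ → −∞, and for every ε ∈ (0, 10⁻²) there exists T such that q(τ) ≤ 2 + ε for all τ ≤ T. -/

import Mathlib

open Filter

noncomputable def qq (Sp Sm : ℝ → ℝ) (τ : ℝ) : ℝ := 2 * (Sp τ ^ 2 + Sm τ ^ 2)

noncomputable def Spl (N1 N2 N3 : ℝ → ℝ) (τ : ℝ) : ℝ :=
  (1 / 2) * ((N2 τ - N3 τ) ^ 2 - N1 τ * (2 * N1 τ - N2 τ - N3 τ))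

noncomputable def Smi (N1 N2 N3 : ℝ → ℝ) (τ : ℝ) : ℝ :=
  (Real.sqrt 3 / 2) * ((N3 τ - N2 τ) * (N1 τ - N2 τ - N3 τ))

/-- The Wainwright–Hsu vacuum constraint. -/
def Constraint (N1 N2 N3 Sp Sm : ℝ → ℝ) (τ : ℝ) : Prop :=
  Sp τ ^ 2 + Sm τ ^ 2 +
      (3 / 4) * (N1 τ ^ 2 + N2 τ ^ 2 + N3 τ ^ 2 -
        2 * (N1 τ * N2 τ + N2 τ * N3 τ + N3 τ * N1 τ)) = 1

/-- `(N1, N2, N3, Sp, Sm)` solves the Wainwright–Hsu system (with constraint) on `S`. -/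
def IsWHSolutionOn (N1 N2 N3 Sp Sm : ℝ → ℝ) (S : Set ℝ) : Prop :=
  ∀ τ ∈ S,
    HasDerivAt N1 ((qq Sp Sm τ - 4 * Sp τ) * N1 τ) τ ∧
    HasDerivAt N2 ((qq Sp Sm τ + 2 * Sp τ + 2 * Real.sqrt 3 * Sm τ) * N2 τ) τ ∧
    HasDerivAt N3 ((qq Sp Sm τ + 2 * Sp τ - 2 * Real.sqrt 3 * Sm τ) * N3 τ) τ ∧
    HasDerivAt Sp (-(2 - qq Sp Sm τ) * Sp τ - 3 * Spl N1 N2 N3 τ) τ ∧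
    HasDerivAt Sm (-(2 - qq Sp Sm τ) * Sm τ - 3 * Smi N1 N2 N3 τ) τ ∧
    Constraint N1 N2 N3 Sp Sm τ

lemma aux_q_sorted (a b c s η : ℝ) (ha : 0 < a) (hab : a ≤ b) (hbc : b ≤ c)
    (hη : 0 < η) (hP : a * b * c ≤ η ^ 3)
    (hc : s + (3 / 4) * (a ^ 2 + b ^ 2 + c ^ 2 - 2 * (a * b + b * c + c * a)) = 1) :
    2 * s ≤ 2 + 12 * η + 30 * η ^ 3 := by
  have hb : 0 < b := lt_of_lt_of_le ha hab
  have hcp : 0 < c := lt_of_lt_of_le hb hbc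
  have hη3 : 0 < η ^ 3 := by positivity
  have hq : 2 * s = 2 + 3 * (a * (b + c)) - (3 / 2) * (a ^ 2 + (b - c) ^ 2) := by
    linarith
  have hac : a * b ≤ a * c := mul_le_mul_of_nonneg_left hbc ha.le
  rcases le_total c 2 with h2 | h2
  · have haη : a ≤ η := by
      have h1 : a ^ 3 ≤ a * b * c := by
        have e1 : a * a ≤ a * b := mul_le_mul_of_nonneg_left hab ha.le
        have e2 : (a * a) * a ≤ (a * b) * c :=
          mul_le_mul e1 (hab.trans hbc) ha.le (by positivity)
        calc a ^ 3 = a * a * a := by ring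
          _ ≤ _ := e2
      exact le_of_pow_le_pow_left₀ (by norm_num) hη.le (h1.trans hP)
    have : a * c ≤ η * 2 := mul_le_mul haη h2 hcp.le hη.le
    nlinarith [sq_nonneg a, sq_nonneg (b - c)]
  · rcases le_total (c / 10) b with h10 | h10
    · have : a * c ≤ 5 * η ^ 3 := by
        have h5 : 1 / 5 ≤ b := by linarith
        have : (a * c) * (1 / 5) ≤ (a * c) * b :=
          mul_le_mul_of_nonneg_left h5 (by positivity)
        linarith [mul_right_comm a b c]
      nlinarith [sq_nonneg a, sq_nonneg (b - c)]
    · have h3 : a * c ≤ c / 10 * c := mul_le_mul_of_nonneg_right (hab.trans h10) hcp.le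
      have h4 : a * b ≤ c / 10 * (c / 10) :=
        mul_le_mul (hab.trans h10) h10 hb.le (by positivity)
      have h5 : (9 / 10 * c) ^ 2 ≤ (c - b) ^ 2 :=
        pow_le_pow_left₀ (by positivity) (by linarith) 2
      nlinarith [sq_nonneg a, sq_nonneg c]

lemma aux_q (a b c s η : ℝ) (ha : 0 < a) (hb : 0 < b) (hc : 0 < c)
    (hη : 0 < η) (hP : a * b * c ≤ η ^ 3)
    (h : s + (3 / 4) * (a ^ 2 + b ^ 2 + c ^ 2 - 2 * (a * b + b * c + c * a)) = 1) :
    2 * s ≤ 2 + 12 * η + 30 * η ^ 3 := by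
  rcases le_total a b with h1 | h1 <;> rcases le_total b c with h2 | h2 <;>
    rcases le_total a c with h3 | h3
  · exact aux_q_sorted a b c s η ha h1 h2 hη hP h
  · exact aux_q_sorted a b c s η ha h1 h2 hη hP h
  · exact aux_q_sorted a c b s η ha h3 h2 hη (by linarith) (by linarith)
  · exact aux_q_sorted c a b s η hc h3 h1 hη (by linarith) (by linarith)
  · exact aux_q_sorted b a c s η hb h1 h3 hη (by linarith) (by linarith)
  · exact aux_q_sorted b c a s η hb h2 h3 hη (by linarith) (by linarith)
  · exact aux_q_sorted c b a s η hc h2 h1 hη (by linarith) (by linarith)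
  · exact aux_q_sorted c b a s η hc h2 h1 hη (by linarith) (by linarith)

lemma aux_alg (a b c : ℝ)
    (h0 : (3 / 4) * (a ^ 2 + b ^ 2 + c ^ 2 - 2 * (a * b + b * c + c * a)) = 1)
    (h1 : (b - c) ^ 2 - a * (2 * a - b - c) = 0)
    (h2 : (c - b) * (a - b - c) = 0) : False := by
  rcases mul_eq_zero.mp h2 with h | h
  · obtain rfl : c = b := by linarith
    have : a * (a - c) = 0 := by linarith
    rcases mul_eq_zero.mp this with h | h
    · subst h; linarith
    · obtain rfl : a = c := by linarith
      nlinarith [sq_nonneg a]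
  · obtain rfl : a = b + c := by linarith
    have : b * c = 0 := by linarith
    nlinarith

lemma aux_step (f f1 : ℝ → ℝ) (t : ℕ → ℝ) (w w' : ℝ) (hw' : 0 ≤ w') (hw : w' < w)
    (ht : ∀ k, t k ≤ 0)
    (hf : ∀ ε > 0, ∀ᶠ k in atTop, ∀ τ ∈ Set.Icc (t k - w) (t k), |f τ| ≤ ε)
    (hd : ∀ τ ≤ 0, HasDerivAt f (f1 τ) τ)
    (heq : ∀ ε > 0, ∃ δ > 0, ∀ᶠ k in atTop, ∀ a ∈ Set.Icc (t k - w) (t k),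
      ∀ b ∈ Set.Icc (t k - w) (t k), |a - b| ≤ δ → |f1 a - f1 b| ≤ ε) :
    ∀ ε > 0, ∀ᶠ k in atTop, ∀ τ ∈ Set.Icc (t k - w') (t k), |f1 τ| ≤ ε := by
  intro ε hε
  obtain ⟨δ0, hδ0, h0⟩ := heq (ε / 2) (by positivity)
  set δ := min δ0 (w - w') with hδdef
  have hδ : 0 < δ := lt_min hδ0 (by linarith)
  have hδ1 : δ ≤ δ0 := min_le_left _ _
  have hδ2 : δ ≤ w - w' := min_le_right _ _
  filter_upwards [h0, hf (ε * δ / 4) (by positivity)] with k h0 h1 τ hτ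
  have htk := ht k
  obtain ⟨hτ1, hτ2⟩ := hτ
  obtain ⟨c, ⟨hc1, hc2⟩, hc⟩ := exists_hasDerivAt_eq_slope f f1 (a := τ - δ) (b := τ)
    (by linarith)
    (fun y hy => (hd y (by linarith [hy.2])).continuousAt.continuousWithinAt)
    (fun y hy => hd y (by linarith [hy.2]))
  have e1 := h1 τ ⟨by linarith, hτ2⟩
  have e2 := h1 (τ - δ) ⟨by linarith, by linarith⟩
  have e3 := h0 τ ⟨by linarith, hτ2⟩ c ⟨by linarith, by linarith⟩
    (by rw [abs_le]; constructor <;> linarith)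
  have e4 : |f1 c| ≤ ε / 2 := by
    have : τ - (τ - δ) = δ := by ring
    rw [hc, this, abs_div, abs_of_pos hδ, div_le_iff₀ hδ]
    calc |f τ - f (τ - δ)| ≤ |f τ| + |f (τ - δ)| := abs_sub _ _
      _ ≤ _ := by linarith
  calc |f1 τ| = |(f1 τ - f1 c) + f1 c| := by ring_nf
    _ ≤ |f1 τ - f1 c| + |f1 c| := abs_add_le _ _
    _ ≤ ε := by linarith

lemma aux_equi {E : Type*} [NormedAddCommGroup E] [NormedSpace ℝ E]
    (x : ℝ → E) (V : E → E) (hV : Continuous V)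
    (hx : ∀ τ ≤ 0, HasDerivAt x (V (x τ)) τ) (t : ℕ → ℝ) (ht : ∀ k, t k ≤ 0) (w : ℝ)
    (K : Set E) (hK : IsCompact K)
    (hxK : ∀ᶠ k in atTop, ∀ τ ∈ Set.Icc (t k - w) (t k), x τ ∈ K)
    (F : E → ℝ) (hF : Continuous F) :
    ∀ ε > 0, ∃ δ > 0, ∀ᶠ k in atTop, ∀ a ∈ Set.Icc (t k - w) (t k),
      ∀ b ∈ Set.Icc (t k - w) (t k), |a - b| ≤ δ → |F (x a) - F (x b)| ≤ ε := by
  intro ε hε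
  obtain ⟨M, hM⟩ := hK.exists_bound_of_continuousOn hV.continuousOn
  have hu := hK.uniformContinuousOn_of_continuous hF.continuousOn
  rw [Metric.uniformContinuousOn_iff] at hu
  obtain ⟨δ, hδ, hu⟩ := hu ε hε
  refine ⟨δ / (2 * (|M| + 1)), by positivity, ?_⟩
  filter_upwards [hxK] with k hk a ha b hb hab
  have hlip : ‖x a - x b‖ ≤ (|M| + 1) * ‖a - b‖ :=
    Convex.norm_image_sub_le_of_norm_hasDerivWithin_le (s := Set.Icc (t k - w) (t k))
      (fun y hy => (hx y (hy.2.trans (ht k))).hasDerivWithinAt)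
      (fun y hy => (hM _ (hk y hy)).trans (by linarith [le_abs_self M]))
      (convex_Icc _ _) hb ha
  have : dist (x a) (x b) < δ := by
    rw [dist_eq_norm]
    have h1 : (|M| + 1) * ‖a - b‖ ≤ (|M| + 1) * (δ / (2 * (|M| + 1))) :=
      mul_le_mul_of_nonneg_left hab (by positivity)
    have h2 : (|M| + 1) * (δ / (2 * (|M| + 1))) = δ / 2 := by
      field_simp
    linarith
  have := hu _ (hk a ha) _ (hk b hb) this
  rw [Real.dist_eq] at this
  exact this.le

lemma aux_growth (N r : ℝ → ℝ) (c : ℝ) (hN : ∀ τ ≤ 0, 0 < N τ)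
    (hd : ∀ τ ≤ 0, HasDerivAt N (r τ * N τ) τ) (hr : ∀ τ ≤ 0, -c ≤ r τ)
    (a b : ℝ) (hab : a ≤ b) (hb : b ≤ 0) : N a ≤ Real.exp (c * (b - a)) * N b := by
  have hder : ∀ τ ≤ 0, HasDerivAt (fun τ => N τ * Real.exp (c * τ))
      ((r τ + c) * (N τ * Real.exp (c * τ))) τ := by
    intro τ hτ
    have h1 : HasDerivAt (fun τ : ℝ => Real.exp (c * τ)) (Real.exp (c * τ) * (c * 1)) τ :=
      ((hasDerivAt_id τ).const_mul c).exp
    have h2 := (hd τ hτ).mul h1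
    have e : r τ * N τ * Real.exp (c * τ) + N τ * (Real.exp (c * τ) * (c * 1)) =
        (r τ + c) * (N τ * Real.exp (c * τ)) := by ring
    rw [e] at h2
    exact h2
  have hm : MonotoneOn (fun τ => N τ * Real.exp (c * τ)) (Set.Iic 0) := by
    apply monotoneOn_of_deriv_nonneg (convex_Iic 0)
    · exact fun y hy => (hder y hy).continuousAt.continuousWithinAt
    · intro y hy
      rw [interior_Iic] at hy
      exact (hder y (le_of_lt hy)).differentiableAt.differentiableWithinAt
    · intro y hy
      rw [interior_Iic] at hy
      have hy : y ≤ 0 := le_of_lt hy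
      rw [(hder y hy).deriv]
      have := hN y hy
      have := hr y hy
      exact mul_nonneg (by linarith) (by positivity)
  have h := hm (show a ∈ Set.Iic 0 from hab.trans hb) (show b ∈ Set.Iic 0 from hb) hab
  have e : Real.exp (c * (b - a)) = Real.exp (c * b) / Real.exp (c * a) := by
    rw [← Real.exp_sub]; ring_nf
  rw [e, div_mul_eq_mul_div, le_div_iff₀ (Real.exp_pos _)]
  linarith

lemma aux_Pderiv (N1 N2 N3 Sp Sm : ℝ → ℝ)
    (hsol : IsWHSolutionOn N1 N2 N3 Sp Sm (Set.Iic 0)) (τ : ℝ) (hτ : τ ≤ 0) :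
    HasDerivAt (fun τ => N1 τ * N2 τ * N3 τ)
      (3 * qq Sp Sm τ * (N1 τ * N2 τ * N3 τ)) τ := by
  obtain ⟨h1, h2, h3, -⟩ := hsol τ hτ
  refine ((h1.mul h2).mul h3).congr_deriv ?_
  change ((qq Sp Sm τ - 4 * Sp τ) * N1 τ * N2 τ +
    N1 τ * ((qq Sp Sm τ + 2 * Sp τ + 2 * Real.sqrt 3 * Sm τ) * N2 τ)) * N3 τ +
    N1 τ * N2 τ * ((qq Sp Sm τ + 2 * Sp τ - 2 * Real.sqrt 3 * Sm τ) * N3 τ) = _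
  ring

lemma aux_Pmono (N1 N2 N3 Sp Sm : ℝ → ℝ)
    (hsol : IsWHSolutionOn N1 N2 N3 Sp Sm (Set.Iic 0))
    (hIX : ∀ τ ≤ (0 : ℝ), 0 < N1 τ ∧ 0 < N2 τ ∧ 0 < N3 τ) :
    MonotoneOn (fun τ => N1 τ * N2 τ * N3 τ) (Set.Iic 0) := by
  have hder := aux_Pderiv N1 N2 N3 Sp Sm hsol
  apply monotoneOn_of_deriv_nonneg (convex_Iic 0)
  · exact fun y hy => (hder y hy).continuousAt.continuousWithinAt
  · intro y hy
    rw [interior_Iic] at hy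
    exact (hder y (le_of_lt hy)).differentiableAt.differentiableWithinAt
  · intro y hy
    rw [interior_Iic] at hy
    have hy : y ≤ 0 := le_of_lt hy
    rw [(hder y hy).deriv]
    obtain ⟨h1, h2, h3⟩ := hIX y hy
    unfold qq
    positivity

lemma aux_lim (N1 N2 N3 Sp Sm : ℝ → ℝ)
    (hsol : IsWHSolutionOn N1 N2 N3 Sp Sm (Set.Iic 0))
    (hIX : ∀ τ ≤ (0 : ℝ), 0 < N1 τ ∧ 0 < N2 τ ∧ 0 < N3 τ) :
    ∃ L : ℝ, 0 ≤ L ∧ Tendsto (fun τ => N1 τ * N2 τ * N3 τ) atBot (nhds L) ∧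
      ∀ τ ≤ 0, L ≤ N1 τ * N2 τ * N3 τ := by
  have hm := aux_Pmono N1 N2 N3 Sp Sm hsol hIX
  set P := fun τ => N1 τ * N2 τ * N3 τ with hP
  have hmono : Monotone (fun τ => P (min τ 0)) := fun a b hab =>
    hm (Set.mem_Iic.mpr (min_le_right _ _)) (Set.mem_Iic.mpr (min_le_right _ _)) (min_le_min_right _ hab)
  have hpos : ∀ τ ≤ 0, 0 ≤ P τ := fun τ hτ => by
    obtain ⟨h1, h2, h3⟩ := hIX τ hτ
    simp only [hP]; positivity
  have hbdd : BddBelow (Set.range (fun τ => P (min τ 0))) :=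
    ⟨0, by rintro _ ⟨τ, rfl⟩; exact hpos _ (min_le_right _ _)⟩
  refine ⟨⨅ τ, P (min τ 0), le_ciInf fun τ => hpos _ (min_le_right _ _), ?_, ?_⟩
  · refine (tendsto_atBot_ciInf hmono hbdd).congr' ?_
    filter_upwards [eventually_le_atBot (0 : ℝ)] with τ hτ
    simp only [min_eq_left hτ]
  · intro τ hτ
    have := ciInf_le hbdd τ
    simpa only [min_eq_left hτ] using this

lemma aux_qB (N1 N2 N3 Sp Sm : ℝ → ℝ)
    (hsol : IsWHSolutionOn N1 N2 N3 Sp Sm (Set.Iic 0))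
    (hIX : ∀ τ ≤ (0 : ℝ), 0 < N1 τ ∧ 0 < N2 τ ∧ 0 < N3 τ) :
    ∃ B : ℝ, 0 < B ∧ ∀ τ ≤ 0, |Sp τ| ≤ B ∧ |Sm τ| ≤ B := by
  have hm := aux_Pmono N1 N2 N3 Sp Sm hsol hIX
  obtain ⟨h1, h2, h3⟩ := hIX 0 le_rfl
  set η := 1 + N1 0 * N2 0 * N3 0 with hη
  have hp : 0 < N1 0 * N2 0 * N3 0 := by positivity
  have hη1 : 1 ≤ η := by linarith
  have hη3 : η ≤ η ^ 3 := le_self_pow₀ hη1 (by norm_num)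
  refine ⟨2 + 12 * η + 30 * η ^ 3, by positivity, fun τ hτ => ?_⟩
  obtain ⟨g1, g2, g3⟩ := hIX τ hτ
  obtain ⟨-, -, -, -, -, hc⟩ := hsol τ hτ
  have hle : N1 τ * N2 τ * N3 τ ≤ N1 0 * N2 0 * N3 0 :=
    hm (show τ ∈ Set.Iic 0 from hτ) (Set.mem_Iic.mpr le_rfl) hτ
  have hq := aux_q _ _ _ _ η g1 g2 g3 (by linarith) (by linarith) hc
  have hB : (1 : ℝ) ≤ 2 + 12 * η + 30 * η ^ 3 := by linarith
  generalize 2 + 12 * η + 30 * η ^ 3 = B at hq hB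
  constructor <;> apply abs_le_of_sq_le_sq _ (by linarith) <;>
    nlinarith [sq_nonneg (Sp τ), sq_nonneg (Sm τ)]

abbrev AuxE := ℝ × ℝ × ℝ × ℝ × ℝ

noncomputable def auxV4 (y : AuxE) : ℝ :=
  -(2 - 2 * (y.2.2.2.1 ^ 2 + y.2.2.2.2 ^ 2)) * y.2.2.2.1 -
    3 * ((1 / 2) * ((y.2.1 - y.2.2.1) ^ 2 - y.1 * (2 * y.1 - y.2.1 - y.2.2.1)))

noncomputable def auxV5 (y : AuxE) : ℝ :=
  -(2 - 2 * (y.2.2.2.1 ^ 2 + y.2.2.2.2 ^ 2)) * y.2.2.2.2 -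
    3 * ((Real.sqrt 3 / 2) * ((y.2.2.1 - y.2.1) * (y.1 - y.2.1 - y.2.2.1)))

noncomputable def auxV (y : AuxE) : AuxE :=
  ((2 * (y.2.2.2.1 ^ 2 + y.2.2.2.2 ^ 2) - 4 * y.2.2.2.1) * y.1,
   (2 * (y.2.2.2.1 ^ 2 + y.2.2.2.2 ^ 2) + 2 * y.2.2.2.1 +
      2 * Real.sqrt 3 * y.2.2.2.2) * y.2.1,
   (2 * (y.2.2.2.1 ^ 2 + y.2.2.2.2 ^ 2) + 2 * y.2.2.2.1 -
      2 * Real.sqrt 3 * y.2.2.2.2) * y.2.2.1,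
   auxV4 y, auxV5 y)

lemma auxV4_cont : Continuous auxV4 := by unfold auxV4; fun_prop
lemma auxV5_cont : Continuous auxV5 := by unfold auxV5; fun_prop
lemma auxV_cont : Continuous auxV := by
  have := auxV4_cont
  have := auxV5_cont
  unfold auxV; fun_prop

lemma aux_Lzero (N1 N2 N3 Sp Sm : ℝ → ℝ)
    (hsol : IsWHSolutionOn N1 N2 N3 Sp Sm (Set.Iic 0))
    (hIX : ∀ τ ≤ (0 : ℝ), 0 < N1 τ ∧ 0 < N2 τ ∧ 0 < N3 τ)
    (p : AuxE) (t : ℕ → ℝ) (ht : ∀ k, t k ≤ 0) (htb : Tendsto t atTop atBot)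
    (hp : Tendsto (fun k => (N1 (t k), N2 (t k), N3 (t k), Sp (t k), Sm (t k)))
        atTop (nhds p)) (L : ℝ) (hL : 0 < L)
    (hlim : Tendsto (fun τ => N1 τ * N2 τ * N3 τ) atBot (nhds L))
    (hLP : ∀ τ ≤ 0, L ≤ N1 τ * N2 τ * N3 τ) : False := by
  obtain ⟨B, hB, hSB⟩ := aux_qB N1 N2 N3 Sp Sm hsol hIX
  set x : ℝ → AuxE := fun τ => (N1 τ, N2 τ, N3 τ, Sp τ, Sm τ) with hxdef
  have hx : ∀ τ ≤ 0, HasDerivAt x (auxV (x τ)) τ := by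
    intro τ hτ
    obtain ⟨h1, h2, h3, h4, h5, -⟩ := hsol τ hτ
    exact h1.prodMk (h2.prodMk (h3.prodMk (h4.prodMk h5)))
  -- boundedness on windows
  have hs3 : Real.sqrt 3 ≤ 2 := by
    rw [Real.sqrt_le_left (by norm_num)]; norm_num
  have hs0 : 0 ≤ Real.sqrt 3 := Real.sqrt_nonneg 3
  have hSs : ∀ τ ≤ 0, |Real.sqrt 3 * Sm τ| ≤ 2 * B := fun τ hτ => by
    rw [abs_mul, abs_of_nonneg hs0]
    exact mul_le_mul hs3 (hSB τ hτ).2 (abs_nonneg _) (by norm_num)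
  have hq0 : ∀ τ, 0 ≤ qq Sp Sm τ := fun τ => by unfold qq; positivity
  set C := Real.exp (6 * B * 2) * (‖p‖ + 1) with hC
  have hxK : ∀ᶠ k in atTop, ∀ τ ∈ Set.Icc (t k - 2) (t k),
      x τ ∈ Metric.closedBall (0 : AuxE) (max C B) := by
    have hn : ∀ᶠ k in atTop, ‖x (t k)‖ < ‖p‖ + 1 :=
      hp.norm.eventually_lt_const (by linarith)
    filter_upwards [hn] with k hk τ hτ
    have htk := ht k
    have hτ0 : τ ≤ 0 := hτ.2.trans htk
    have key : ∀ (N r : ℝ → ℝ), (∀ τ ≤ 0, 0 < N τ) →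
        (∀ τ ≤ 0, HasDerivAt N (r τ * N τ) τ) → (∀ τ ≤ 0, -(6 * B) ≤ r τ) →
        ‖N (t k)‖ ≤ ‖x (t k)‖ → ‖N τ‖ ≤ max C B := by
      intro N r hN hd hr hle
      have h1 := aux_growth N r (6 * B) hN hd hr τ (t k) hτ.2 htk
      have h2 : Real.exp (6 * B * (t k - τ)) ≤ Real.exp (6 * B * 2) := by
        apply Real.exp_le_exp.mpr
        exact mul_le_mul_of_nonneg_left (by linarith [hτ.1]) (by positivity)
      have h3 : N (t k) ≤ ‖p‖ + 1 := (le_abs_self _).trans (hle.trans hk.le)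
      rw [Real.norm_of_nonneg (hN τ hτ0).le]
      refine le_trans (h1.trans ?_) (le_max_left C B)
      exact mul_le_mul h2 h3 (hN _ htk).le (Real.exp_pos _).le
    rw [mem_closedBall_zero_iff]
    simp only [hxdef, Prod.norm_def, sup_le_iff]
    refine ⟨?_, ?_, ?_, (hSB τ hτ0).1.trans (le_max_right _ _),
      (hSB τ hτ0).2.trans (le_max_right _ _)⟩
    · refine key N1 _ (fun τ h => (hIX τ h).1) (fun τ h => (hsol τ h).1) ?_ ?_
      · intro τ h
        linarith [hq0 τ, (abs_le.mp (hSB τ h).1).2]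
      · exact norm_fst_le (x (t k))
    · refine key N2 _ (fun τ h => (hIX τ h).2.1) (fun τ h => (hsol τ h).2.1) ?_ ?_
      · intro τ h
        linarith [hq0 τ, (abs_le.mp (hSB τ h).1).1, (abs_le.mp (hSs τ h)).1]
      · exact (norm_fst_le (x (t k)).2).trans (norm_snd_le (x (t k)))
    · refine key N3 _ (fun τ h => (hIX τ h).2.2) (fun τ h => (hsol τ h).2.2.1) ?_ ?_
      · intro τ h
        linarith [hq0 τ, (abs_le.mp (hSB τ h).1).1, (abs_le.mp (hSs τ h)).2]
      · exact (norm_fst_le (x (t k)).2.2).trans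
          ((norm_snd_le (x (t k)).2).trans (norm_snd_le (x (t k))))
  have hcomp : IsCompact (Metric.closedBall (0 : AuxE) (max C B)) :=
    isCompact_closedBall _ _
  have hequi := aux_equi x auxV auxV_cont hx t ht 2 _ hcomp hxK
  have hxK1 : ∀ᶠ k in atTop, ∀ τ ∈ Set.Icc (t k - 1) (t k),
      x τ ∈ Metric.closedBall (0 : AuxE) (max C B) := by
    filter_upwards [hxK] with k hk τ hτ
    exact hk τ ⟨by linarith [hτ.1], hτ.2⟩
  have hequi1 := aux_equi x auxV auxV_cont hx t ht 1 _ hcomp hxK1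
  -- q small on windows
  have hqs := aux_step (fun τ => N1 τ * N2 τ * N3 τ - L)
    (fun τ => 3 * qq Sp Sm τ * (N1 τ * N2 τ * N3 τ)) t 2 1 (by norm_num) (by norm_num) ht
    (by
      intro ε hε
      have h1 : ∀ᶠ τ in atBot, |N1 τ * N2 τ * N3 τ - L| < ε := by
        have := (Metric.tendsto_nhds.mp hlim) ε hε
        simpa only [Real.dist_eq] using this
      obtain ⟨T, hT⟩ := eventually_atBot.mp h1
      filter_upwards [htb.eventually_le_atBot T] with k hk τ hτ
      exact (hT τ (hτ.2.trans hk)).le)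
    (fun τ hτ => (aux_Pderiv N1 N2 N3 Sp Sm hsol τ hτ).sub_const L)
    (hequi (fun y => 3 * (2 * (y.2.2.2.1 ^ 2 + y.2.2.2.2 ^ 2)) * (y.1 * y.2.1 * y.2.2.1))
      (by fun_prop))
  have hS : ∀ ε > 0, ∀ᶠ k in atTop, ∀ τ ∈ Set.Icc (t k - 1) (t k),
      |Sp τ| ≤ ε ∧ |Sm τ| ≤ ε := by
    intro ε hε
    filter_upwards [hqs (6 * L * ε ^ 2) (by positivity)] with k hk τ hτ
    have h1 := (le_abs_self _).trans (hk τ hτ)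
    have h2 := hLP τ (hτ.2.trans (ht k))
    have h3 : 3 * qq Sp Sm τ * L ≤ 6 * L * ε ^ 2 :=
      le_trans (mul_le_mul_of_nonneg_left h2 (by linarith [hq0 τ])) h1
    have h4 : Sp τ ^ 2 + Sm τ ^ 2 ≤ ε ^ 2 := by
      unfold qq at h3
      have : (6 * L) * (Sp τ ^ 2 + Sm τ ^ 2) ≤ (6 * L) * ε ^ 2 := by linarith
      exact le_of_mul_le_mul_left this (by positivity)
    constructor <;> apply abs_le_of_sq_le_sq _ hε.le <;>
      nlinarith [sq_nonneg (Sp τ), sq_nonneg (Sm τ)]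
  have h4 := aux_step Sp (fun τ => auxV4 (x τ)) t 1 0 le_rfl (by norm_num) ht
    (fun ε hε => (hS ε hε).mono fun k hk τ hτ => (hk τ hτ).1)
    (fun τ hτ => (hsol τ hτ).2.2.2.1) (hequi1 auxV4 auxV4_cont)
  have h5 := aux_step Sm (fun τ => auxV5 (x τ)) t 1 0 le_rfl (by norm_num) ht
    (fun ε hε => (hS ε hε).mono fun k hk τ hτ => (hk τ hτ).2)
    (fun τ hτ => (hsol τ hτ).2.2.2.2.1) (hequi1 auxV5 auxV5_cont)
  -- pass to the limit
  have hx' : Tendsto (fun k => x (t k)) atTop (nhds p) := hp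
  have lim0 : ∀ G : AuxE → ℝ, Continuous G →
      (∀ ε > 0, ∀ᶠ k in atTop, |G (x (t k))| ≤ ε) → G p = 0 := by
    intro G hG h
    have l1 : Tendsto (fun k => |G (x (t k))|) atTop (nhds |G p|) :=
      ((hG.tendsto p).comp hx').abs
    have : |G p| ≤ 0 := le_of_forall_pos_le_add fun ε hε => by
      rw [zero_add]; exact le_of_tendsto l1 (h ε hε)
    exact abs_eq_zero.mp (le_antisymm this (abs_nonneg _))
  have p4 : p.2.2.2.1 = 0 := lim0 (fun y => y.2.2.2.1) (by fun_prop) fun ε hε =>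
    (hS ε hε).mono fun k hk => (hk (t k) ⟨by linarith, le_rfl⟩).1
  have p5 : p.2.2.2.2 = 0 := lim0 (fun y => y.2.2.2.2) (by fun_prop) fun ε hε =>
    (hS ε hε).mono fun k hk => (hk (t k) ⟨by linarith, le_rfl⟩).2
  have q4 : auxV4 p = 0 := lim0 auxV4 auxV4_cont fun ε hε =>
    (h4 ε hε).mono fun k hk => hk (t k) ⟨by linarith, le_rfl⟩
  have q5 : auxV5 p = 0 := lim0 auxV5 auxV5_cont fun ε hε =>
    (h5 ε hε).mono fun k hk => hk (t k) ⟨by linarith, le_rfl⟩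
  have qc := lim0 (fun y => y.2.2.2.1 ^ 2 + y.2.2.2.2 ^ 2 +
      (3 / 4) * (y.1 ^ 2 + y.2.1 ^ 2 + y.2.2.1 ^ 2 -
        2 * (y.1 * y.2.1 + y.2.1 * y.2.2.1 + y.2.2.1 * y.1)) - 1) (by fun_prop)
    fun ε hε => Eventually.of_forall fun k => by
      have hc := (hsol (t k) (ht k)).2.2.2.2.2
      unfold Constraint at hc
      simp only [hxdef]
      rw [hc]; simpa using hε.le
  simp only [auxV4, auxV5, p4, p5] at q4 q5 qc
  have hs : Real.sqrt 3 ≠ 0 := by positivity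
  refine aux_alg p.1 p.2.1 p.2.2.1 (by linarith) (by linarith) ?_
  have : Real.sqrt 3 * ((p.2.2.1 - p.2.1) * (p.1 - p.2.1 - p.2.2.1)) = 0 := by linarith
  exact (mul_eq_zero.mp this).resolve_left hs

/-- For a Bianchi IX Wainwright–Hsu solution possessing an α-limit point,
`N₁N₂N₃ → 0` as `τ → -∞`, and `q` is eventually below `2 + ε` for every
`ε ∈ (0, 10⁻²)`. -/
theorem stmt_18 (N1 N2 N3 Sp Sm : ℝ → ℝ)
    (hsol : IsWHSolutionOn N1 N2 N3 Sp Sm (Set.Iic 0))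
    (hIX : ∀ τ ≤ (0 : ℝ), 0 < N1 τ ∧ 0 < N2 τ ∧ 0 < N3 τ)
    (hlimit : ∃ (p : ℝ × ℝ × ℝ × ℝ × ℝ) (t : ℕ → ℝ), (∀ k, t k ≤ 0) ∧
      Tendsto t atTop atBot ∧
      Tendsto (fun k => (N1 (t k), N2 (t k), N3 (t k), Sp (t k), Sm (t k)))
        atTop (nhds p)) :
    Tendsto (fun τ => N1 τ * N2 τ * N3 τ) atBot (nhds 0) ∧
    ∀ ε : ℝ, 0 < ε → ε < 1 / 100 → ∃ T ≤ (0 : ℝ), ∀ τ ≤ T, qq Sp Sm τ ≤ 2 + ε := by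
  obtain ⟨p, t, ht, htb, hp⟩ := hlimit
  obtain ⟨L, hL0, hlim, hLP⟩ := aux_lim N1 N2 N3 Sp Sm hsol hIX
  have hL : L = 0 := by
    by_contra hne
    exact aux_Lzero N1 N2 N3 Sp Sm hsol hIX p t ht htb hp L
      (lt_of_le_of_ne hL0 (Ne.symm hne)) hlim hLP
  subst hL
  refine ⟨hlim, fun ε hε hε1 => ?_⟩
  have hη : 0 < ε / 50 := by positivity
  have h1 : ∀ᶠ τ in atBot, N1 τ * N2 τ * N3 τ < (ε / 50) ^ 3 :=
    hlim.eventually_lt_const (by positivity)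
  obtain ⟨T, hT⟩ := eventually_atBot.mp h1
  refine ⟨min T 0, min_le_right _ _, fun τ hτ => ?_⟩
  have hτ0 : τ ≤ 0 := hτ.trans (min_le_right _ _)
  obtain ⟨g1, g2, g3⟩ := hIX τ hτ0
  have hq := aux_q _ _ _ _ (ε / 50) g1 g2 g3 hη (hT τ (hτ.trans (min_le_left _ _))).le
    (hsol τ hτ0).2.2.2.2.2
  have h3 : (ε / 50) ^ 3 ≤ ε / 50 := pow_le_of_le_one hη.le (by linarith) (by norm_num)
  unfold qq
  linarith
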